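/- arXiv:2006.06987 — 4 statements merged into one kernel-verified Lean document; each statement's English description precedes it below -/
import Mathlib

section
/- Ordinary lumpability of aggregated transition rates: let ℛ be a finite set of reactions, each reaction r having reactant vector ρ_r ∈ ℕ^𝒮, product vector π_r ∈ ℕ^𝒮, and propensity f_r : ℕ^𝒮 → ℝ≥0 well-defined for ρ_r. Fix an observation bound O ∈ ℕ^𝒮, a tracked state o ≤ O, a buffer vector ξ ∈ ℕ^𝒮, and set σ := o + ξ. Then for every σ' ∈ ℕ^𝒮: the sum, over all r ∈ ℛ such that η_r ≤ ξ and (σ ⊖ (o + η_r)) + (o'_r + ψ_r) = σ' (where η_r = ρ_r ⊖ o, ψ_r = ((o ⊖ ρ_r) + π_r) ⊖ O and o'_r = O ∧ ((o ⊖ ρ_r) + π_r)), of the expanded propensities evaluated at the single-tracked state ⟦o⟧ + ξ (each equal to f_r(σ)), equals the sum of f_r(σ) over all r ∈ ℛ such that ρ_r ≤ σ and (σ ⊖ ρ_r) + π_r = σ'. -/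
open scoped NNReal
open Finset

attribute [local instance] Classical.propDecidable

/-- **Ordinary lumpability of aggregated transition rates.** Let `ℛ` be a finite
set of reactions, reaction `r` having reactants `ρ r`, products `π r` and
propensity `f r` well-defined for `ρ r`. Fix an observation bound `O`, a tracked
state `o ≤ O`, a buffer vector `ξ`, and set `σ = o + ξ`. For every `σ'`, the sum
over all reactions `r` whose expanded reaction at `⟦o⟧` is enabled in the
single-tracked state `⟦o⟧ + ξ` (i.e. `η_r = ρ r ⊖ o ≤ ξ`) and leads to aggregate
state `σ'` (i.e. `(σ ⊖ (o + η_r)) + (o'_r + ψ_r) = σ'`, with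
`ψ_r = ((o ⊖ ρ r) + π r) ⊖ O` and `o'_r = O ⊓ ((o ⊖ ρ r) + π r)`) of the expanded
propensities at `⟦o⟧ + ξ` — each equal to `f r σ` — equals the sum of `f r σ`
over all `r` with `ρ r ≤ σ` and `(σ ⊖ ρ r) + π r = σ'`. -/
theorem fse_lumpability {𝒮 : Type*} [Fintype 𝒮] [DecidableEq 𝒮]
    {R : Type*} [Fintype R]
    (ρ π : R → 𝒮 → ℕ) (f : R → (𝒮 → ℕ) → ℝ≥0)
    (hwd : ∀ r, ∀ σ : 𝒮 → ℕ, ¬ ρ r ≤ σ → f r σ = 0)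
    (O o ξ : 𝒮 → ℕ) (ho : o ≤ O)
    (σ : 𝒮 → ℕ) (hσ : σ = o + ξ) (σ' : 𝒮 → ℕ) :
    ∑ r ∈ univ.filter (fun r =>
        (ρ r - o) ≤ ξ ∧
          (σ - (o + (ρ r - o)))
              + ((O ⊓ ((o - ρ r) + π r)) + (((o - ρ r) + π r) - O)) = σ'),
        f r σ
      = ∑ r ∈ univ.filter (fun r => ρ r ≤ σ ∧ (σ - ρ r) + π r = σ'), f r σ := by
  subst hσ
  refine Finset.sum_congr (Finset.filter_congr fun r _ => ?_) fun _ _ => rfl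
  have h1 : (ρ r - o) ≤ ξ ↔ ρ r ≤ o + ξ := tsub_le_iff_left
  rw [h1]
  refine and_congr_right fun h => ?_
  have h2 : ((o + ξ) - (o + (ρ r - o)))
      + ((O ⊓ ((o - ρ r) + π r)) + (((o - ρ r) + π r) - O)) = ((o + ξ) - ρ r) + π r := by
    funext s
    have hs := h s
    simp only [Pi.add_apply, Pi.sub_apply, Pi.inf_apply] at hs ⊢
    omega
  rw [h2]
end

section
/- Aggregated master-equation drift identity (core of the soundness theorem): let ℛ be a finite set of reactions, each reaction r having reactant vector ρ_r ∈ ℕ^𝒮, product vector π_r ∈ ℕ^𝒮, and propensity f_r : ℕ^𝒮 → ℝ≥0 well-defined for ρ_r, and fix an observation bound O ∈ ℕ^𝒮. Let P̂ assign a real number to every single-tracked state ⟦o⟧ + ξ, extended by zero to any formal expanded state that has a negative component or is not single-tracked. For a single-tracked state z define the expanded drift D̂(z) := Σ_{r ∈ ℛ} Σ_{ε ≤ O} [ f_{r,ε}(z + (⟦ε⟧ + η_{r,ε}) − (⟦ε'_{r,ε}⟧ + ψ_{r,ε}))·P̂(z + (⟦ε⟧ + η_{r,ε}) − (⟦ε'_{r,ε}⟧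 + ψ_{r,ε})) − f_{r,ε}(z)·P̂(z) ], where η_{r,ε} = ρ_r ⊖ ε, ψ_{r,ε} = ((ε ⊖ ρ_r) + π_r) ⊖ O, ε'_{r,ε} = O ∧ ((ε ⊖ ρ_r) + π_r), and both f_{r,ε} and P̂ are taken to be zero on any formal state with a negative component. Then for every σ ∈ ℕ^𝒮, Σ_{o ≤ O, o ≤ σ} D̂(⟦o⟧ + (σ − o)) = Σ_{r ∈ ℛ} [ f_r(σ + ρ_r − π_r)·Q(σ + ρ_r − π_r) − f_r(σ)·Q(σ) ], where Q(τ) := Σ_{o ≤ O, o ≤ τ} P̂(⟦o⟧ + (τ − o)) and terms in which σ + ρ_r − π_r has a negative component are omitted. -/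
open scoped NNReal

attribute [local instance] Classical.propDecidable

namespace FSE

variable {𝒮 : Type*} [Fintype 𝒮] [DecidableEq 𝒮]

/-- Tracked states: population vectors bounded by the observation bound `O`. -/
def Tracked (O : 𝒮 → ℕ) : Type _ := {o : 𝒮 → ℕ // o ≤ O}

instance (O : 𝒮 → ℕ) : Fintype (Tracked O) :=
  Fintype.subtype (Finset.Iic O) fun _ => Finset.mem_Iic

/-- Expanded species: original (buffer) species `𝒮` plus one auxiliary species
`⟦o⟧` for every tracked state `o ≤ O`. -/
def ExpSpecies (O : 𝒮 → ℕ) : Type _ := 𝒮 ⊕ Tracked O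

/-- The single-tracked expanded state `⟦o⟧ + ξ`: it assigns `1` to the tracked
species `⟦o⟧`, `0` to every other tracked species, and `ξ S` to each buffer
species `S ∈ 𝒮` (viewed as an integer-valued formal state). -/
noncomputable def singleTracked (O : 𝒮 → ℕ) (o : Tracked O) (ξ : 𝒮 → ℕ) : ExpSpecies O → ℤ
  | Sum.inl S => ξ S
  | Sum.inr p => if p = o then 1 else 0

/-- The expanded propensity `f_ε` of a reaction with propensity `f`, conditioned
on tracked state `⟦ε⟧`: `f_ε(z) = z(⟦ε⟧) · f(ε + z|𝒮)`, extended by zero to any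
formal state with a negative component. -/
noncomputable def expProp (O : 𝒮 → ℕ) (f : (𝒮 → ℕ) → ℝ≥0) (ε : Tracked O)
    (z : ExpSpecies O → ℤ) : ℝ :=
  if ∀ x, 0 ≤ z x then
    (z (Sum.inr ε) : ℝ) * (f (ε.1 + fun S => (z (Sum.inl S)).toNat) : ℝ)
  else 0

/-- The change-of-state vector `(⟦ε⟧ + η) − (⟦ε'⟧ + ψ)` of the expanded reaction
`⟦ε⟧ + η → ⟦ε'⟧ + ψ` obtained from a reaction `ρ → π` at tracked state `ε`,
where `η = ρ ⊖ ε`, `ψ = ((ε ⊖ ρ) + π) ⊖ O` and `ε' = O ⊓ ((ε ⊖ ρ) + π)`: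
adding it to a target state gives the corresponding source state. -/
noncomputable def jump (O ρ π : 𝒮 → ℕ) (ε : Tracked O) : ExpSpecies O → ℤ
  | Sum.inl S => ((ρ - ε.1) S : ℤ) - ((((ε.1 - ρ) + π) - O) S : ℤ)
  | Sum.inr p => (if p = ε then 1 else 0)
      - (if p = (⟨O ⊓ ((ε.1 - ρ) + π), inf_le_left⟩ : Tracked O) then 1 else 0)

/-- The master-equation drift `D̂(z)` of the expanded network at a formal
expanded state `z`, with `P̂` extended by zero off the single-tracked states. -/
noncomputable def expDrift (O : 𝒮 → ℕ) {R : Type*} [Fintype R]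
    (ρ π : R → 𝒮 → ℕ) (f : R → (𝒮 → ℕ) → ℝ≥0)
    (Phat : (ExpSpecies O → ℤ) → ℝ) (z : ExpSpecies O → ℤ) : ℝ :=
  ∑ r : R, ∑ ε : Tracked O,
    (expProp O (f r) ε (z + jump O (ρ r) (π r) ε)
          * Phat (z + jump O (ρ r) (π r) ε)
      - expProp O (f r) ε z * Phat z)

/-- The aggregate `Q(τ) = Σ_{o ≤ O, o ≤ τ} P̂(⟦o⟧ + (τ − o))` of a distribution
over the single-tracked expanded states. -/
noncomputable def aggregate (O : 𝒮 → ℕ) (Phat : (ExpSpecies O → ℤ) → ℝ)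
    (τ : 𝒮 → ℕ) : ℝ :=
  ∑ o : Tracked O, if o.1 ≤ τ then Phat (singleTracked O o (τ - o.1)) else 0

lemma expProp_single (O : 𝒮 → ℕ) (f : (𝒮 → ℕ) → ℝ≥0) (ε o : Tracked O) (ξ : 𝒮 → ℕ) :
    expProp O f ε (singleTracked O o ξ) = if ε = o then (f (o.1 + ξ) : ℝ) else 0 := by
  have h : ∀ x, 0 ≤ singleTracked O o ξ x := by
    rintro (S | p)
    · simp [singleTracked]
    · simp only [singleTracked]; split_ifs <;> simp
  unfold expProp
  rw [if_pos h]
  by_cases h2 : ε = o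
  · subst h2
    simp [singleTracked]
  · simp [singleTracked, h2]

lemma expProp_jump_ne (O ρ π : 𝒮 → ℕ) (f : (𝒮 → ℕ) → ℝ≥0) (ε o : Tracked O) (ξ : 𝒮 → ℕ)
    (h : o ≠ (⟨O ⊓ ((ε.1 - ρ) + π), inf_le_left⟩ : Tracked O)) :
    expProp O f ε (singleTracked O o ξ + jump O ρ π ε) = 0 := by
  unfold expProp
  split_ifs with hn
  · by_cases h2 : ε = (⟨O ⊓ ((ε.1 - ρ) + π), inf_le_left⟩ : Tracked O)
    · have h3 : ε ≠ o := fun e => h (e ▸ h2)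
      have : (singleTracked O o ξ + jump O ρ π ε) (Sum.inr ε) = 0 := by
        change (if ε = o then (1:ℤ) else 0) + ((if ε = ε then 1 else 0)
          - (if ε = (⟨O ⊓ ((ε.1 - ρ) + π), inf_le_left⟩ : Tracked O) then 1 else 0)) = 0
        rw [if_neg h3, if_pos h2, if_pos rfl]; rfl
      rw [this]; simp
    · exfalso
      obtain ⟨q, hq⟩ : ∃ q : Tracked O, (⟨O ⊓ ((ε.1 - ρ) + π), inf_le_left⟩ : Tracked O) = q :=
        ⟨_, rfl⟩
      rw [hq] at h h2
      have h0 := hn (Sum.inr q)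
      have h1 : (singleTracked O o ξ + jump O ρ π ε) (Sum.inr q) = -1 := by
        change (if q = o then (1:ℤ) else 0) + ((if q = ε then (1:ℤ) else 0)
          - (if q = (⟨O ⊓ ((ε.1 - ρ) + π), inf_le_left⟩ : Tracked O) then (1:ℤ) else 0)) = -1
        rw [if_neg (Ne.symm h), if_neg (Ne.symm h2), hq, if_pos rfl]; rfl
      rw [h1] at h0
      norm_num at h0
  · rfl

lemma inflow (O ρ π : 𝒮 → ℕ) (f : (𝒮 → ℕ) → ℝ≥0)
    (hwd : ∀ σ : 𝒮 → ℕ, ¬ ρ ≤ σ → f σ = 0)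
    (Phat : (ExpSpecies O → ℤ) → ℝ) (σ : 𝒮 → ℕ) (ε o : Tracked O)
    (ho : o = (⟨O ⊓ ((ε.1 - ρ) + π), inf_le_left⟩ : Tracked O)) :
    (if o.1 ≤ σ then expProp O f ε (singleTracked O o (σ - o.1) + jump O ρ π ε)
      * Phat (singleTracked O o (σ - o.1) + jump O ρ π ε) else 0)
    = if π ≤ σ + ρ then (f ((σ + ρ) - π) : ℝ) *
        (if ε.1 ≤ (σ + ρ) - π then Phat (singleTracked O ε ((σ + ρ) - π - ε.1)) else 0) else 0 := by
  have hoS : ∀ S, o.1 S = min (O S) ((ε.1 S - ρ S) + π S) := by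
    intro S; rw [ho]; rfl
  have hinl : ∀ S, (singleTracked O o (σ - o.1) + jump O ρ π ε) (Sum.inl S)
      = ((σ S - o.1 S : ℕ) : ℤ) + (((ρ S - ε.1 S : ℕ) : ℤ) - ((((ε.1 S - ρ S) + π S) - O S : ℕ) : ℤ)) := by
    intro S; rfl
  have hinr : ∀ p, (singleTracked O o (σ - o.1) + jump O ρ π ε) (Sum.inr p)
      = if p = ε then 1 else 0 := by
    intro p
    change (if p = o then (1:ℤ) else 0) + ((if p = ε then 1 else 0)
          - (if p = (⟨O ⊓ ((ε.1 - ρ) + π), inf_le_left⟩ : Tracked O) then 1 else 0)) = _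
    rw [← ho]; ring
  by_cases hA : o.1 ≤ σ ∧ ∀ S, 0 ≤ (singleTracked O o (σ - o.1) + jump O ρ π ε) (Sum.inl S)
  · obtain ⟨h1, h2⟩ := hA
    have h3 : π ≤ σ + ρ := by
      intro S
      have a : o.1 S ≤ σ S := h1 S; have b := h2 S; have c := hoS S
      rw [hinl] at b
      simp only [Pi.add_apply]
      omega
    have h4 : ε.1 ≤ σ + ρ - π := by
      intro S
      have a : o.1 S ≤ σ S := h1 S; have b := h2 S; have c := hoS S
      rw [hinl] at b
      simp only [Pi.add_apply, Pi.sub_apply]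
      omega
    have h5 : singleTracked O o (σ - o.1) + jump O ρ π ε
        = singleTracked O ε ((σ + ρ) - π - ε.1) := by
      funext x
      rcases x with S | p
      · have a : o.1 S ≤ σ S := h1 S; have b := h2 S; have c := hoS S
        rw [hinl] at b ⊢
        simp only [singleTracked, Pi.add_apply, Pi.sub_apply]
        omega
      · rw [hinr]; rfl
    rw [if_pos h1, if_pos h3, if_pos h4, h5, expProp_single, if_pos rfl, add_tsub_cancel_of_le h4]
  · have hL : (if o.1 ≤ σ then expProp O f ε (singleTracked O o (σ - o.1) + jump O ρ π ε)
        * Phat (singleTracked O o (σ - o.1) + jump O ρ π ε) else 0) = 0 := by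
      split_ifs with h1
      · have : expProp O f ε (singleTracked O o (σ - o.1) + jump O ρ π ε) = 0 := by
          unfold expProp
          rw [if_neg]
          intro hn
          exact hA ⟨h1, fun S => hn _⟩
        rw [this, zero_mul]
      · rfl
    rw [hL]
    symm
    split_ifs with h3 h4
    · rw [hwd, NNReal.coe_zero, zero_mul]
      intro h5
      apply hA
      have key : ∀ S, (ε.1 S - ρ S) + π S ≤ σ S := by
        intro S
        have a := h3 S; have b := h4 S; have c := h5 S
        simp only [Pi.add_apply, Pi.sub_apply] at a b c
        omega
      refine ⟨fun S => ?_, fun S => ?_⟩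
      · have := key S; have := hoS S
        change o.1 S ≤ σ S
        omega
      · rw [hinl]
        have := key S; have := hoS S; omega
    · simp
    · rfl

/-- **Aggregated master-equation drift identity (core of the soundness
theorem).** Let `ℛ` be a finite set of reactions with well-defined propensities,
`O` an observation bound, and `P̂` a distribution supported on the
single-tracked expanded states (it vanishes on any formal expanded state that is
not single-tracked, in particular on states with a negative component). Then
for every aggregate state `σ`, the sum over all tracked `o ≤ O` with `o ≤ σ` of
the expanded drifts `D̂(⟦o⟧ + (σ − o))` equals the original master-equation
drift at `σ` of the aggregated distribution
`Q(τ) = Σ_{o ≤ O, o ≤ τ} P̂(⟦o⟧ + (τ − o))`, terms in which `σ + ρ r − π r`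
has a negative component (i.e. `π r ≤ σ + ρ r` fails) being omitted. -/
theorem fse_aggregated_drift {R : Type*} [Fintype R]
    (O : 𝒮 → ℕ) (ρ π : R → 𝒮 → ℕ) (f : R → (𝒮 → ℕ) → ℝ≥0)
    (hwd : ∀ r, ∀ σ : 𝒮 → ℕ, ¬ ρ r ≤ σ → f r σ = 0)
    (Phat : (ExpSpecies O → ℤ) → ℝ)
    (hPhat : ∀ z : ExpSpecies O → ℤ,
      (∀ (o : Tracked O) (ξ : 𝒮 → ℕ), z ≠ singleTracked O o ξ) → Phat z = 0)
    (σ : 𝒮 → ℕ) :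
    (∑ o : Tracked O,
        if o.1 ≤ σ then expDrift O ρ π f Phat (singleTracked O o (σ - o.1)) else 0)
      = ∑ r : R,
          ((if π r ≤ σ + ρ r then
              (f r ((σ + ρ r) - π r) : ℝ) * aggregate O Phat ((σ + ρ r) - π r)
            else 0)
            - (f r σ : ℝ) * aggregate O Phat σ) := by
  have hD : ∀ o : Tracked O,
      (if o.1 ≤ σ then expDrift O ρ π f Phat (singleTracked O o (σ - o.1)) else 0)
      = ∑ r : R, ((∑ ε : Tracked O,
          if o.1 ≤ σ then
            expProp O (f r) ε (singleTracked O o (σ - o.1) + jump O (ρ r) (π r) ε)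
            * Phat (singleTracked O o (σ - o.1) + jump O (ρ r) (π r) ε) else 0)
          - (f r σ : ℝ) * (if o.1 ≤ σ then Phat (singleTracked O o (σ - o.1)) else 0)) := by
    intro o
    split_ifs with h
    · unfold expDrift
      refine Finset.sum_congr rfl fun r _ => ?_
      rw [Finset.sum_sub_distrib]
      congr 1
      simp only [expProp_single, add_tsub_cancel_of_le h, ite_mul, zero_mul]
      rw [Finset.sum_ite_eq']
      simp
    · simp
  rw [Finset.sum_congr rfl fun o _ => hD o, Finset.sum_comm]
  refine Finset.sum_congr rfl fun r _ => ?_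
  rw [Finset.sum_sub_distrib]
  congr 1
  · rw [Finset.sum_comm]
    have hE : ∀ ε : Tracked O, (∑ o : Tracked O,
          if o.1 ≤ σ then
            expProp O (f r) ε (singleTracked O o (σ - o.1) + jump O (ρ r) (π r) ε)
            * Phat (singleTracked O o (σ - o.1) + jump O (ρ r) (π r) ε) else 0)
        = if π r ≤ σ + ρ r then (f r ((σ + ρ r) - π r) : ℝ) *
        (if ε.1 ≤ (σ + ρ r) - π r then
          Phat (singleTracked O ε ((σ + ρ r) - π r - ε.1)) else 0) else 0 := by
      intro ε
      refine (Finset.sum_eq_single (⟨O ⊓ ((ε.1 - ρ r) + π r), inf_le_left⟩ : Tracked O) ?_ ?_).trans ?_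
      rotate_left 2
      · exact inflow O (ρ r) (π r) (f r) (hwd r) Phat σ ε _ rfl
      · intro o _ hne
        rw [expProp_jump_ne O (ρ r) (π r) (f r) ε o _ hne]
        simp
      · intro h; exact absurd (Finset.mem_univ (α := Tracked O) _) h
    rw [Finset.sum_congr rfl fun ε _ => hE ε]
    unfold aggregate
    split_ifs
    · rw [Finset.mul_sum]
    · simp
  · unfold aggregate
    rw [Finset.mul_sum]

end FSE
end

section
/- Tracked-species drift equals master-equation drift in the full expansion (core of Theorem 4, case ii): let ℛ be a finite set of reactions, each reaction r having reactant vector ρ_r ∈ ℕ^𝒮, product vector π_r ∈ ℕ^𝒮, and propensity f_r : ℕ^𝒮 → ℝ≥0 well-defined for ρ_r. Let P : ℕ^𝒮 → ℝ be any function. Then for every o ∈ ℕ^𝒮: Σ_{r ∈ ℛ} Σ_{ε ∈ ℕ^𝒮, (ε ⊖ ρ_r) + π_r = o} P(ε)·f_r(ε) − Σ_{r ∈ ℛ} P(o)·f_r(o) = Σ_{r ∈ ℛ} [ f_r(o + ρ_r − π_r)·P(o + ρ_r − π_r) − f_r(o)·P(o) ], where the inner sum on the left has at most one nonzero term per reaction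 (by well-definedness) and terms on the right in which o + ρ_r − π_r has a negative component are omitted. -/
open scoped NNReal

attribute [local instance] Classical.propDecidable

/-- **Tracked-species drift equals master-equation drift in the full expansion
(core of Theorem 4, case ii).** Let `ℛ` be a finite set of reactions, reaction
`r` having reactants `ρ r`, products `π r` and propensity `f r` well-defined for
`ρ r`, and let `P : ℕ^𝒮 → ℝ` be any function. Then for every tracked state `o`,
the DRE right-hand side for the tracked species `⟦o⟧` (with all buffer
coordinates zero and tracked coordinates given by `P`) equals the chemical
master equation drift for state `o`:
`Σ_r Σᶠ_{ε : (ε ⊖ ρ r) + π r = o} P(ε)·f_r(ε) − Σ_r P(o)·f_r(o)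
  = Σ_r [ f_r(o + ρ r − π r)·P(o + ρ r − π r) − f_r(o)·P(o) ]`,
where terms on the right in which `o + ρ r − π r` has a negative component
(i.e. `π r ≤ o + ρ r` fails) are omitted. -/
theorem fse_full_expansion_tracked_drift {𝒮 : Type*} [Fintype 𝒮]
    {R : Type*} [Fintype R]
    (ρ π : R → 𝒮 → ℕ) (f : R → (𝒮 → ℕ) → ℝ≥0)
    (hwd : ∀ r, ∀ σ : 𝒮 → ℕ, ¬ ρ r ≤ σ → f r σ = 0)
    (P : (𝒮 → ℕ) → ℝ) (o : 𝒮 → ℕ) :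
    (∑ r : R, ∑ᶠ ε ∈ {ε : 𝒮 → ℕ | (ε - ρ r) + π r = o}, P ε * (f r ε : ℝ))
        - ∑ r : R, P o * (f r o : ℝ)
      = ∑ r : R,
          ((if π r ≤ o + ρ r then (f r ((o + ρ r) - π r) : ℝ) * P ((o + ρ r) - π r) else 0)
            - (f r o : ℝ) * P o) := by
  rw [← Finset.sum_sub_distrib]
  refine Finset.sum_congr rfl fun r _ => ?_
  have key : (∑ᶠ ε ∈ {ε : 𝒮 → ℕ | (ε - ρ r) + π r = o}, P ε * (f r ε : ℝ))
      = if π r ≤ o + ρ r then (f r ((o + ρ r) - π r) : ℝ) * P ((o + ρ r) - π r) else 0 := by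
    rw [finsum_eq_single _ ((o + ρ r) - π r)]
    · by_cases hf : ρ r ≤ (o + ρ r) - π r
      · by_cases h : π r ≤ o + ρ r
        · have hm : ((o + ρ r) - π r) ∈ {ε : 𝒮 → ℕ | (ε - ρ r) + π r = o} := by
            funext s
            have h1 := hf s
            have h2 := h s
            simp only [Pi.add_apply, Pi.sub_apply] at h1 h2 ⊢
            omega
          rw [finsum_eq_if, if_pos hm, if_pos h, mul_comm]
        · have hm : ((o + ρ r) - π r) ∉ {ε : 𝒮 → ℕ | (ε - ρ r) + π r = o} := by
            intro hm
            apply h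
            intro s
            have h1 := congrFun hm s
            simp only [Pi.add_apply, Pi.sub_apply] at h1 ⊢
            omega
          rw [finsum_eq_if, if_neg hm, if_neg h]
      · simp [hwd r _ hf]
    · intro ε hε
      rw [finsum_eq_if]
      split_ifs with hm
      · have : ¬ ρ r ≤ ε := by
          intro hle
          apply hε
          funext s
          have h1 := congrFun hm s
          have h2 : ρ r s ≤ ε s := hle s
          simp only [Pi.add_apply, Pi.sub_apply] at h1 ⊢
          omega
        simp [hwd r _ this]
      · rfl
  rw [key, mul_comm (P o)]
end

section
/- Asymptotic correctness of finite state expansion (Theorem 4, solution form): let ℛ be a finite set of reactions, each reaction r having reactant vector ρ_r ∈ ℕ^𝒮, product vector π_r ∈ ℕ^𝒮, and propensity f_r : ℕ^𝒮 → ℝ≥0 well-defined for ρ_r. Suppose X assigns to each time t ∈ ℝ a value X_t(⟦o⟧) ∈ ℝ for every tracked species ⟦o⟧ (o ∈ ℕ^𝒮) and the value X_t(S) = 0 to every original species S ∈ 𝒮, with each coordinate t ↦ X_t(⟦o⟧) differentiable and satisfying the deterministic rate equation of the fully expanded network: d/dt X_t(⟦o⟧) = Σ_{r ∈ ℛ}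 Σ_{ε ∈ ℕ^𝒮, (ε ⊖ ρ_r) + π_r = o} X_t(⟦ε⟧)·f_r(ε) − Σ_{r ∈ ℛ} X_t(⟦o⟧)·f_r(o) (the inner sum having at most one nonzero term per reaction by well-definedness). Then P_t(o) := X_t(⟦o⟧) satisfies the chemical master equation of the original network: d/dt P_t(o) = Σ_{r ∈ ℛ} [ f_r(o + ρ_r − π_r)·P_t(o + ρ_r − π_r) − f_r(o)·P_t(o) ], where terms in which o + ρ_r − π_r has a negative component are omitted. -/
open scoped NNReal

attribute [local instance] Classical.propDecidable

/-- **Asymptotic correctness of finite state expansion (Theorem 4, solution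
form).** Let `ℛ` be a finite set of reactions, reaction `r` having reactants
`ρ r`, products `π r` and propensity `f r` well-defined for `ρ r`. Suppose
`X t ⟦o⟧ = X t o` assigns to each time `t` a value for every tracked species
`⟦o⟧` (`o : 𝒮 → ℕ`), the original (buffer) species being held at `0`, each
coordinate being differentiable in `t` and satisfying the deterministic rate
equation of the fully expanded network:
`d/dt X_t(⟦o⟧) = Σ_r Σᶠ_{ε : (ε ⊖ ρ r) + π r = o} X_t(⟦ε⟧)·f_r(ε) − Σ_r X_t(⟦o⟧)·f_r(o)`.
Then `P_t(o) := X_t(⟦o⟧)` satisfies the chemical master equation of the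
original network:
`d/dt P_t(o) = Σ_r [ f_r(o + ρ r − π r)·P_t(o + ρ r − π r) − f_r(o)·P_t(o) ]`,
terms in which `o + ρ r − π r` has a negative component (i.e. `π r ≤ o + ρ r`
fails) being omitted. -/
theorem fse_asymptotic_correctness {𝒮 : Type*} [Fintype 𝒮]
    {R : Type*} [Fintype R]
    (ρ π : R → 𝒮 → ℕ) (f : R → (𝒮 → ℕ) → ℝ≥0)
    (hwd : ∀ r, ∀ σ : 𝒮 → ℕ, ¬ ρ r ≤ σ → f r σ = 0)
    (X : ℝ → (𝒮 → ℕ) → ℝ)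
    (hX : ∀ (t : ℝ) (o : 𝒮 → ℕ),
      HasDerivAt (fun s => X s o)
        ((∑ r : R, ∑ᶠ ε ∈ {ε : 𝒮 → ℕ | (ε - ρ r) + π r = o}, X t ε * (f r ε : ℝ))
          - ∑ r : R, X t o * (f r o : ℝ)) t) :
    ∀ (t : ℝ) (o : 𝒮 → ℕ),
      HasDerivAt (fun s => X s o)
        (∑ r : R,
          ((if π r ≤ o + ρ r then (f r ((o + ρ r) - π r) : ℝ) * X t ((o + ρ r) - π r) else 0)
            - (f r o : ℝ) * X t o)) t := by
  intro t o
  convert hX t o using 1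
  rw [← Finset.sum_sub_distrib]
  refine Finset.sum_congr rfl fun r _ => ?_
  rw [mul_comm (X t o)]
  congr 1
  symm
  rw [finsum_eq_single _ ((o + ρ r) - π r)]
  · by_cases hf : ρ r ≤ (o + ρ r) - π r
    · by_cases hp : π r ≤ o + ρ r
      · have h : (o + ρ r) - π r - ρ r + π r = o := by
          funext i
          have h1 := hf i
          have h2 := hp i
          simp only [Pi.add_apply, Pi.sub_apply] at *
          omega
        rw [if_pos hp, finsum_eq_if, if_pos (by exact h), mul_comm]
      · have h : ¬ ((o + ρ r) - π r - ρ r + π r = o) := by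
          intro h
          apply hp
          intro i
          have h1 := hf i
          have h2 := congrFun h i
          simp only [Pi.add_apply, Pi.sub_apply] at *
          omega
        rw [if_neg hp, finsum_eq_if, if_neg (by exact h)]
    · simp [hwd r _ hf]
  · intro ε hε
    rw [finsum_eq_if]
    split_ifs with h
    · by_cases hf : ρ r ≤ ε
      · exfalso
        apply hε
        funext i
        have h1 := hf i
        have h2 := congrFun h i
        simp only [Pi.add_apply, Pi.sub_apply] at *
        omega
      · simp [hwd r _ hf]
    · rfl
end
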